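/- Let ω > 0 and τ > 0, and define the delay sine sin_τ(ω, ·) : ℝ → ℝ by sin_τ(ω, t) = 0 for t < −τ and, for each integer k ≥ 0 and t ∈ [(k−1)τ, kτ), sin_τ(ω, t) = Σ_{j=0}^{k} (−1)^j ω^{2j+1} (t − (j−1)τ)^{2j+1} / (2j+1)!. Then sin_τ(ω, ·) is continuously differentiable on (−τ, ∞), equals ω(t + τ) on [−τ, 0), and satisfies x''(t) + ω² x(t − τ) = 0 for all t > 0. -/

import Mathlib

open Set MeasureTheory intervalIntegral Finset

/-- The truncated power `(max u 0) ^ (n + 2)` is differentiable, with the expected derivative. -/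
theorem hasDerivAt_max_zero_pow (n : ℕ) (u : ℝ) :
    HasDerivAt (fun v : ℝ => max v 0 ^ (n + 2)) ((n + 2 : ℝ) * max u 0 ^ (n + 1)) u := by
  rcases lt_trichotomy u 0 with hu | rfl | hu
  · have h : (fun v : ℝ => max v 0 ^ (n + 2)) =ᶠ[nhds u] fun _ => 0 := by
      filter_upwards [Iio_mem_nhds hu] with v hv
      simp [max_eq_right (le_of_lt (mem_Iio.1 hv))]
    simpa [max_eq_right hu.le] using (hasDerivAt_const u (0 : ℝ)).congr_of_eventuallyEq h
  · have hpow : HasDerivAt (fun v : ℝ => v ^ (n + 2)) 0 0 := by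
      simpa using hasDerivAt_pow (n + 2) (0 : ℝ)
    rw [hasDerivAt_iff_isLittleO_nhds_zero] at hpow ⊢
    refine (Asymptotics.isBigO_of_le _ fun h => ?_).trans_isLittleO hpow
    simp only [zero_add, max_self, smul_zero, mul_zero, sub_zero, ne_eq, Nat.succ_ne_zero,
      not_false_eq_true, zero_pow, norm_pow, Real.norm_eq_abs]
    refine pow_le_pow_left₀ (abs_nonneg _) ?_ _
    rw [abs_of_nonneg (le_max_right h 0)]
    exact max_le (le_abs_self h) (abs_nonneg h)
  · have h : (fun v : ℝ => max v 0 ^ (n + 2)) =ᶠ[nhds u] fun v => v ^ (n + 2) := by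
      filter_upwards [Ioi_mem_nhds hu] with v hv
      rw [max_eq_left (le_of_lt (mem_Ioi.1 hv))]
    have hd := (hasDerivAt_pow (n + 2) u).congr_of_eventuallyEq h
    rw [max_eq_left hu.le]
    exact_mod_cast hd

theorem contDiff_max_zero_pow (n : ℕ) : ContDiff ℝ 1 (fun v : ℝ => max v 0 ^ (n + 2)) := by
  rw [contDiff_one_iff_deriv]
  refine ⟨fun u => (hasDerivAt_max_zero_pow n u).differentiableAt, ?_⟩
  rw [funext fun u => (hasDerivAt_max_zero_pow n u).deriv]
  fun_prop

/-- The coefficient of the `j`-th term of the delay sine. -/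
noncomputable def delaySineCoeff (ω : ℝ) (j : ℕ) : ℝ :=
  (-1) ^ j * ω ^ (2 * j + 1) / (Nat.factorial (2 * j + 1) : ℝ)

theorem delaySineCoeff_succ (ω : ℝ) (j : ℕ) :
    delaySineCoeff ω (j + 1) * (2 * j + 3) * (2 * j + 2) = -ω ^ 2 * delaySineCoeff ω j := by
  have h : (Nat.factorial (2 * j + 1) : ℝ) ≠ 0 := by positivity
  have h2 : (2 * j + 2 : ℝ) ≠ 0 := by positivity
  have h3 : (2 * j + 3 : ℝ) ≠ 0 := by positivity
  have hf : (Nat.factorial (2 * (j + 1) + 1) : ℝ)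
      = (2 * j + 3) * ((2 * j + 2) * Nat.factorial (2 * j + 1)) := by
    rw [show 2 * (j + 1) + 1 = (2 * j + 1 + 1) + 1 by ring, Nat.factorial_succ, Nat.factorial_succ]
    push_cast
    ring
  unfold delaySineCoeff
  rw [hf]
  field_simp
  ring

/-- The first `N + 1` terms of the delay sine, written with truncated powers in the terms of
degree at least three. -/
noncomputable def delaySineSum (ω τ : ℝ) (N : ℕ) (t : ℝ) : ℝ :=
  ω * (t + τ) + ∑ j ∈ Finset.range N,
    delaySineCoeff ω (j + 1) * max (t - j * τ) 0 ^ (2 * j + 1 + 2)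

theorem contDiff_delaySineSum (ω τ : ℝ) (N : ℕ) : ContDiff ℝ 1 (delaySineSum ω τ N) := by
  unfold delaySineSum
  refine ContDiff.add (by fun_prop) (ContDiff.sum fun j _ => contDiff_const.mul ?_)
  exact (contDiff_max_zero_pow (2 * j + 1)).comp (contDiff_id.sub contDiff_const)

theorem hasDerivAt_delaySineSum (ω τ : ℝ) (N : ℕ) (t : ℝ) :
    HasDerivAt (delaySineSum ω τ N)
      (ω + ∑ j ∈ Finset.range N,
        delaySineCoeff ω (j + 1) * ((2 * j + 3) * max (t - j * τ) 0 ^ (2 * j + 2))) t := by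
  unfold delaySineSum
  refine HasDerivAt.add ?_ (HasDerivAt.fun_sum fun j _ => HasDerivAt.const_mul _ ?_)
  · simpa using ((hasDerivAt_id t).add_const τ).const_mul ω
  · refine ((hasDerivAt_max_zero_pow (2 * j + 1) (t - j * τ)).comp_sub_const t (j * τ)).congr_deriv ?_
    push_cast
    ring

theorem hasDerivAt_deriv_delaySineSum (ω τ : ℝ) (N : ℕ) (t : ℝ) :
    HasDerivAt (deriv (delaySineSum ω τ N))
      (-ω ^ 2 * ∑ j ∈ Finset.range N,
        delaySineCoeff ω j * max (t - j * τ) 0 ^ (2 * j + 1)) t := by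
  rw [funext fun u => (hasDerivAt_delaySineSum ω τ N u).deriv, Finset.mul_sum]
  refine HasDerivAt.const_add ω (HasDerivAt.fun_sum fun j _ => ?_)
  refine ((((hasDerivAt_max_zero_pow (2 * j) (t - j * τ)).comp_sub_const t (j * τ)).const_mul
    (2 * j + 3 : ℝ)).const_mul (delaySineCoeff ω (j + 1))).congr_deriv ?_
  push_cast
  linear_combination max (t - j * τ) 0 ^ (2 * j + 1) * delaySineCoeff_succ ω j

/-- A function given stepwise by the delay sine polynomials is a single sum of truncated powers
on each interval `[-τ, N * τ)`. -/
theorem eq_sum_max_pow_of_step {ω τ : ℝ} (hτ : 0 < τ) {S : ℝ → ℝ}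
    (hSstep : ∀ k : ℕ, ∀ t ∈ Ico (((k : ℝ) - 1) * τ) ((k : ℝ) * τ),
      S t = ∑ j ∈ Finset.range (k + 1),
        (-1 : ℝ) ^ j * ω ^ (2 * j + 1) * (t - ((j : ℝ) - 1) * τ) ^ (2 * j + 1)
          / (Nat.factorial (2 * j + 1) : ℝ))
    (N : ℕ) {t : ℝ} (ht : -τ ≤ t) (htN : t < N * τ) :
    S t = ∑ j ∈ Finset.range (N + 1),
      delaySineCoeff ω j * max (t - ((j : ℝ) - 1) * τ) 0 ^ (2 * j + 1) := by
  set k := ⌊(t + τ) / τ⌋₊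
  have hk₁ : ((k : ℝ) - 1) * τ ≤ t := by
    have := Nat.floor_le (div_nonneg (by linarith : 0 ≤ t + τ) hτ.le)
    rw [le_div_iff₀ hτ] at this
    linarith
  have hk₂ : t < k * τ := by
    have := Nat.lt_floor_add_one ((t + τ) / τ)
    rw [div_lt_iff₀ hτ] at this
    linarith
  have hkN : k ≤ N := by
    have : ((k : ℝ) - 1) < N := lt_of_mul_lt_mul_right (hk₁.trans_lt htN) hτ.le
    exact Nat.lt_succ_iff.1 (by exact_mod_cast (by linarith : (k : ℝ) < N + 1))
  rw [hSstep k t ⟨hk₁, hk₂⟩]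
  refine Eq.trans (Finset.sum_congr rfl fun j hj => ?_)
    (Finset.sum_subset (Finset.range_mono (Nat.succ_le_succ hkN)) fun j _ hj => ?_)
  · have hjk : (j : ℝ) ≤ k := by exact_mod_cast Nat.lt_succ_iff.1 (Finset.mem_range.1 hj)
    have := mul_le_mul_of_nonneg_right hjk hτ.le
    rw [max_eq_left (by linarith), delaySineCoeff]
    ring
  · have hjk : (k : ℝ) + 1 ≤ j := by exact_mod_cast not_lt.1 (mt Finset.mem_range.2 hj)
    have := mul_le_mul_of_nonneg_right hjk hτ.le
    rw [max_eq_right (by linarith)]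
    simp

theorem sum_max_pow_eq_delaySineSum (ω : ℝ) {τ : ℝ} (N : ℕ) {t : ℝ} (ht : -τ ≤ t) :
    ∑ j ∈ Finset.range (N + 1),
      delaySineCoeff ω j * max (t - ((j : ℝ) - 1) * τ) 0 ^ (2 * j + 1) = delaySineSum ω τ N t := by
  rw [Finset.sum_range_succ', delaySineSum, add_comm]
  congr 1
  · rw [max_eq_left (by push_cast; linarith)]
    simp [delaySineCoeff]
  · refine Finset.sum_congr rfl fun j _ => ?_
    rw [Nat.cast_succ, add_sub_cancel_right, show 2 * (j + 1) + 1 = 2 * j + 1 + 2 by ring]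

/-- The delay sine `sin_τ(ω, ·)` — vanishing below `−τ` and given on each step interval
`[(k−1)τ, kτ)` by the alternating polynomial sum — is continuously differentiable on
`(−τ, ∞)`, equals `ω(t + τ)` on `[−τ, 0)`, and solves the pure-delay oscillation equation
`x''(t) + ω² x(t − τ) = 0` for `t > 0`. -/
theorem delay_sine_properties
    (ω τ : ℝ) (hω : 0 < ω) (hτ : 0 < τ)
    (S : ℝ → ℝ)
    (hSpast : ∀ t < -τ, S t = 0)
    (hSstep : ∀ k : ℕ, ∀ t ∈ Ico (((k : ℝ) - 1) * τ) ((k : ℝ) * τ),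
      S t = ∑ j ∈ Finset.range (k + 1),
        (-1 : ℝ) ^ j * ω ^ (2 * j + 1) * (t - ((j : ℝ) - 1) * τ) ^ (2 * j + 1)
          / (Nat.factorial (2 * j + 1) : ℝ)) :
    ContDiffOn ℝ 1 S (Ioi (-τ)) ∧
    (∀ t ∈ Ico (-τ) (0 : ℝ), S t = ω * (t + τ)) ∧
    (∀ t > 0, deriv (deriv S) t + ω ^ 2 * S (t - τ) = 0) := by
  have hloc : ∀ t > -τ, ∃ N : ℕ, t < (N + 1 : ℕ) * τ ∧ S =ᶠ[nhds t] delaySineSum ω τ (N + 1) := by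
    intro t ht
    obtain ⟨N, hN⟩ := exists_nat_gt (t / τ)
    rw [div_lt_iff₀ hτ] at hN
    have hN' : t < (N + 1 : ℕ) * τ := by push_cast; linarith
    refine ⟨N, hN', ?_⟩
    filter_upwards [Ioi_mem_nhds ht, Iio_mem_nhds hN'] with u hu hu'
    rw [eq_sum_max_pow_of_step hτ hSstep (N + 1) (le_of_lt hu) hu',
      sum_max_pow_eq_delaySineSum ω (N + 1) (le_of_lt hu)]
  refine ⟨fun t ht => ?_, fun t ht => ?_, fun t ht => ?_⟩
  · obtain ⟨N, -, hN⟩ := hloc t ht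
    exact ((contDiff_delaySineSum ω τ (N + 1)).contDiffAt.congr_of_eventuallyEq hN).contDiffWithinAt
  · rw [hSstep 0 t (by simpa using ht)]
    simp
  · obtain ⟨N, htN, hN⟩ := hloc t (by linarith)
    push_cast at htN
    rw [hN.deriv.deriv_eq, (hasDerivAt_deriv_delaySineSum ω τ (N + 1) t).deriv,
      eq_sum_max_pow_of_step hτ hSstep N (by linarith : -τ ≤ t - τ) (by linarith)]
    have hshift : ∀ j : ℕ, t - τ - ((j : ℝ) - 1) * τ = t - j * τ := fun j => by ring
    simp only [hshift]
    ring
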